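/- The vertex-edge graph of a polytope P = {x : A x ≥ b} is the image of the graph of lex-feasible bases under the map φ sending a lex-feasible basis I to the first column of X^I = A_I^{-1} b̃_I. That is, the vertices of P are exactly {φ(I) : I lex-feasible}, and (u, u') is an edge of the vertex-edge graph with u ≠ u' iff there exist adjacent lex-feasible bases I, J with φ(I) = u and φ(J) = u'. -/

import Mathlib

open Matrix

/-- The polyhedron `{x : A x ≥ b}`. -/
def PolyhedronOf {m n : ℕ} (A : Matrix (Fin m) (Fin n) ℝ) (b : Fin m → ℝ) :
    Set (Fin n → ℝ) :=
  {x | ∀ i, b i ≤ A.mulVec x i}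

/-- `v` is a vertex of `P`: a zero-dimensional face. -/
def IsVertex {n : ℕ} (P : Set (Fin n → ℝ)) (v : Fin n → ℝ) : Prop :=
  ∃ c : Fin n → ℝ, {x ∈ P | ∀ y ∈ P, c ⬝ᵥ x ≤ c ⬝ᵥ y} = {v}

/-- `(u, u')` is an edge of the vertex-edge graph of `P`: the segment `[u, u']` is a
one-dimensional face of `P` cut out by some objective. -/
def IsEdge {n : ℕ} (P : Set (Fin n → ℝ)) (u u' : Fin n → ℝ) : Prop :=
  u ≠ u' ∧ ∃ c : Fin n → ℝ, {x ∈ P | ∀ y ∈ P, c ⬝ᵥ x ≤ c ⬝ᵥ y} = segment ℝ u u'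

/-- Lexicographic order on row vectors in `ℝ^{1+m}`. -/
def lexLe {m : ℕ} (u v : Fin (m + 1) → ℝ) : Prop :=
  u = v ∨ ∃ k, (∀ j, j < k → u j = v j) ∧ u k < v k

/-- The perturbed right-hand side `b̃ = [b, -Id_m]`. -/
def btilde {m : ℕ} (b : Fin m → ℝ) : Matrix (Fin m) (Fin (m + 1)) ℝ :=
  fun i j => if j = 0 then b i else if (j : ℕ) = (i : ℕ) + 1 then -1 else 0

/-- The basic matrix `X^I = A_I⁻¹ b̃_I` of the basis given by `r`. -/
noncomputable def basicMatrix {m n : ℕ} (A : Matrix (Fin m) (Fin n) ℝ)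
    (b : Fin m → ℝ) (r : Fin n ↪ Fin m) : Matrix (Fin n) (Fin (m + 1)) ℝ :=
  (A.submatrix r id)⁻¹ * (btilde b).submatrix r id

/-- `r` describes a lex-feasible basis: `A_I` is nonsingular and `A X^I ≥_lex b̃`. -/
def IsLexFeasible {m n : ℕ} (A : Matrix (Fin m) (Fin n) ℝ) (b : Fin m → ℝ)
    (r : Fin n ↪ Fin m) : Prop :=
  (A.submatrix r id).det ≠ 0 ∧
  ∀ i, lexLe ((btilde b) i) ((A * basicMatrix A b r) i)

/-- `φ(I)`: the first column of `X^I`. -/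
noncomputable def phi {m n : ℕ} (A : Matrix (Fin m) (Fin n) ℝ) (b : Fin m → ℝ)
    (r : Fin n ↪ Fin m) : Fin n → ℝ :=
  fun j => basicMatrix A b r j 0

section Lexicographic

variable {m : ℕ}

theorem lexLe_iff_toLex_le (u v : Fin (m + 1) → ℝ) : lexLe u v ↔ toLex u ≤ toLex v := by
  rw [le_iff_eq_or_lt, toLex_inj]
  rfl

theorem apply_zero_le_of_toLex_le {u v : Fin (m + 1) → ℝ} (h : toLex u ≤ toLex v) :
    u 0 ≤ v 0 := by
  rcases (lexLe_iff_toLex_le u v).2 h with rfl | ⟨k, hk, hlt⟩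
  · exact le_rfl
  · rcases eq_or_ne k 0 with rfl | hk0
    · exact hlt.le
    · exact (hk 0 (Fin.pos_of_ne_zero hk0)).le

instance posSMulStrictMono_lex : PosSMulStrictMono ℝ (Lex (Fin (m + 1) → ℝ)) where
  smul_lt_smul_of_pos_left := by
    rintro a ha u v ⟨k, hk, hlt⟩
    exact ⟨k, fun j hj => congrArg (a * ·) (hk j hj), mul_lt_mul_of_pos_left hlt ha⟩

/-- The ratio test: the largest step keeping all slacks nonnegative makes one of them vanish. -/
theorem exists_ratio_test {ι L : Type*} [Finite ι] [AddCommGroup L] [LinearOrder L]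
    [IsOrderedAddMonoid L] [Module ℝ L] [PosSMulStrictMono ℝ L] (s : ι → L) (a : ι → ℝ)
    (hs : ∀ i, 0 ≤ s i) (ha : ∃ i, a i < 0) :
    ∃ t : L, 0 ≤ t ∧ (∃ i, a i < 0 ∧ s i + a i • t = 0) ∧ ∀ i, 0 ≤ s i + a i • t := by
  obtain ⟨i, hi, hmin⟩ := Set.exists_min_image {i | a i < 0} (fun i => (-a i)⁻¹ • s i)
    (Set.toFinite _) ha
  have hi' : 0 < -a i := neg_pos.2 hi
  have ht : 0 ≤ (-a i)⁻¹ • s i := smul_nonneg (inv_nonneg.2 hi'.le) (hs i)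
  refine ⟨(-a i)⁻¹ • s i, ht, ⟨i, hi, ?_⟩, fun k => ?_⟩
  · rw [smul_smul, inv_neg, mul_neg, mul_inv_cancel₀ (ne_of_lt hi), neg_one_smul, add_neg_cancel]
  · rcases lt_or_ge (a k) 0 with hk | hk
    · have h := smul_le_smul_of_nonneg_left (hmin k hk) (neg_pos.2 hk).le
      rw [smul_smul (-a k) (-a k)⁻¹, mul_inv_cancel₀ (neg_pos.2 hk).ne', one_smul, neg_smul] at h
      exact neg_le_iff_add_nonneg.1 h
    · exact add_nonneg (hs k) (smul_nonneg hk ht)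

end Lexicographic

section Polyhedron

variable {m n : ℕ} {A : Matrix (Fin m) (Fin n) ℝ} {b : Fin m → ℝ}

theorem btilde_apply_zero (b : Fin m → ℝ) (i : Fin m) : btilde b i 0 = b i := rfl

theorem btilde_apply_succ (b : Fin m → ℝ) (i k : Fin m) :
    btilde b i k.succ = if k = i then -1 else 0 := by
  simp [btilde, Fin.ext_iff]

theorem exists_mulVec_neg (hbounded : ∃ R : ℝ, ∀ x ∈ PolyhedronOf A b, ∀ j, |x j| ≤ R)
    (hne : (PolyhedronOf A b).Nonempty) {y : Fin n → ℝ} (hy : y ≠ 0) :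
    ∃ i, (A *ᵥ y) i < 0 := by
  by_contra! hA
  obtain ⟨R, hR⟩ := hbounded
  obtain ⟨x, hx⟩ := hne
  obtain ⟨j, hj⟩ := Function.ne_iff.1 hy
  have hj' : 0 < |y j| := abs_pos.2 hj
  have hR0 : 0 ≤ R := (abs_nonneg _).trans (hR x hx j)
  have hs : 0 ≤ (2 * R + 1) / |y j| := by positivity
  have hmem : x + ((2 * R + 1) / |y j|) • y ∈ PolyhedronOf A b := fun i => by
    have h1 := hx i
    have h2 := mul_nonneg hs (hA i)
    simp only [mulVec_add, mulVec_smul, Pi.add_apply, Pi.smul_apply, smul_eq_mul]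
    linarith
  have h1 := hR _ hmem j
  have h2 := hR x hx j
  have h3 : |((2 * R + 1) / |y j|) * y j| = 2 * R + 1 := by
    rw [abs_mul, abs_of_nonneg hs, div_mul_cancel₀ _ hj'.ne']
  simp only [Pi.add_apply, Pi.smul_apply, smul_eq_mul] at h1
  have h4 := abs_sub (x j + ((2 * R + 1) / |y j|) * y j) (x j)
  rw [add_sub_cancel_left, h3] at h4
  linarith

/-- Moving from a lex-feasible matrix along a direction until a constraint becomes tight. -/
theorem exists_lex_step {X : Matrix (Fin n) (Fin (m + 1)) ℝ}
    (hX : ∀ i, toLex (btilde b i) ≤ toLex ((A * X) i)) {y : Fin n → ℝ}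
    (hy : ∃ i, (A *ᵥ y) i < 0) :
    ∃ t : Fin (m + 1) → ℝ, 0 ≤ toLex t ∧
      (∃ i, (A *ᵥ y) i < 0 ∧ (A * (X + vecMulVec y t)) i = btilde b i ∧
        (t = 0 → (A * X) i = btilde b i)) ∧
      ∀ i, toLex (btilde b i) ≤ toLex ((A * (X + vecMulVec y t)) i) := by
  have hrow : ∀ t i, (A * (X + vecMulVec y t)) i = (A * X) i + (A *ᵥ y) i • t := fun t i => by
    rw [Matrix.mul_add, mul_vecMulVec]
    rfl
  obtain ⟨t, ht, ⟨i, hi, hi0⟩, hnn⟩ := exists_ratio_test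
    (fun i => toLex ((A * X) i) - toLex (btilde b i)) (A *ᵥ y) (fun i => sub_nonneg.2 (hX i)) hy
  refine ⟨ofLex t, ht, ⟨i, hi, ?_, ?_⟩, fun k => ?_⟩
  · rw [sub_add_eq_add_sub, sub_eq_zero] at hi0
    rw [hrow]
    exact toLex_inj.1 hi0
  · intro h0
    have h0' : t = 0 := h0
    rw [h0', smul_zero, add_zero, sub_eq_zero] at hi0
    exact toLex_inj.1 hi0
  · rw [hrow, ← sub_nonneg]
    have h := hnn k
    rw [sub_add_eq_add_sub] at h
    exact h

theorem basicMatrix_apply_mem {r : Fin n ↪ Fin m} (hr : (A.submatrix r id).det ≠ 0) (k : Fin n) :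
    (A * basicMatrix A b r) (r k) = btilde b (r k) := by
  have h : A.submatrix r id * basicMatrix A b r = (btilde b).submatrix r id := by
    rw [basicMatrix, Matrix.mul_nonsing_inv_cancel_left _ _ (isUnit_iff_ne_zero.2 hr)]
  exact congrFun h k

theorem eq_basicMatrix {r : Fin n ↪ Fin m} (hr : (A.submatrix r id).det ≠ 0)
    {X : Matrix (Fin n) (Fin (m + 1)) ℝ} (hX : ∀ k, (A * X) (r k) = btilde b (r k)) :
    X = basicMatrix A b r := by
  have h : A.submatrix r id * X = (btilde b).submatrix r id := funext hX
  rw [basicMatrix, ← h, Matrix.nonsing_inv_mul_cancel_left _ _ (isUnit_iff_ne_zero.2 hr)]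

theorem mulVec_phi_apply_mem {r : Fin n ↪ Fin m} (hr : (A.submatrix r id).det ≠ 0) (k : Fin n) :
    (A *ᵥ phi A b r) (r k) = b (r k) :=
  congrFun (basicMatrix_apply_mem hr k) 0

theorem IsLexFeasible.phi_mem {r : Fin n ↪ Fin m} (hr : IsLexFeasible A b r) :
    phi A b r ∈ PolyhedronOf A b := fun i =>
  apply_zero_le_of_toLex_le ((lexLe_iff_toLex_le _ _).1 (hr.2 i))

theorem eq_zero_of_mulVec_range_eq_zero {r : Fin n ↪ Fin m} (hr : (A.submatrix r id).det ≠ 0)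
    {z : Fin n → ℝ} (hz : ∀ k, (A *ᵥ z) (r k) = 0) : z = 0 := by
  by_contra h
  exact hr (exists_mulVec_eq_zero_iff.1 ⟨z, h, funext hz⟩)

/-- Constraints outside of a basis are not tight at its basic matrix. -/
theorem mul_basicMatrix_ne {r : Fin n ↪ Fin m} {i : Fin m} (hi : i ∉ Set.range r) :
    (A * basicMatrix A b r) i ≠ btilde b i := by
  intro h
  have h1 := congrFun h i.succ
  have h2 : ∀ j, basicMatrix A b r j i.succ = 0 := fun j => by
    simp only [basicMatrix, Matrix.mul_apply, submatrix_apply, id]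
    refine Finset.sum_eq_zero fun k _ => ?_
    rw [btilde_apply_succ, if_neg fun hk => hi ⟨k, hk.symm⟩, mul_zero]
  rw [btilde_apply_succ, if_pos rfl, Matrix.mul_apply] at h1
  simp [h2] at h1

/-- A family of rows with trivial common kernel contains a basis. -/
theorem exists_basis_of_kernel_trivial {T : Set (Fin m)}
    (hT : ∀ y : Fin n → ℝ, (∀ i ∈ T, (A *ᵥ y) i = 0) → y = 0) :
    ∃ r : Fin n ↪ Fin m, (∀ k, r k ∈ T) ∧ (A.submatrix r id).det ≠ 0 := by
  obtain ⟨κ, a, ha, hspan, hli⟩ := exists_linearIndependent' ℝ (fun i : T => A.row i)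
  have htop : Submodule.span ℝ (Set.range fun i : T => A.row i) = ⊤ := by
    by_contra hlt
    obtain ⟨f, hf0, hf⟩ := Submodule.exists_le_ker_of_lt_top _ (lt_top_iff_ne_top.2 hlt)
    have hdot : ∀ x, f x = x ⬝ᵥ fun j => f (Pi.single j 1) := fun x => by
      conv_lhs => rw [pi_eq_sum_univ' x]
      simp [dotProduct]
    apply hf0
    have hz := hT (fun j => f (Pi.single j 1)) fun i hi => by
      have h := hf (Submodule.subset_span ⟨⟨i, hi⟩, rfl⟩)
      rw [LinearMap.mem_ker, hdot] at h
      exact h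
    ext x
    simp [congrFun hz]
  have hfin : Finite κ := Finite.of_injective a ha
  have : Fintype κ := Fintype.ofFinite κ
  have hcard : Fintype.card κ = n := by
    have h := finrank_span_eq_card hli
    rw [hspan, htop, finrank_top, Module.finrank_fin_fun] at h
    exact h.symm
  let e : Fin n ≃ κ := (Fintype.equivFinOfCardEq hcard).symm
  refine ⟨⟨fun k => a (e k), fun k l h => e.injective (ha (Subtype.ext h))⟩,
    fun k => (a (e k)).2, ?_⟩
  rw [← isUnit_iff_ne_zero, ← Matrix.isUnit_iff_isUnit_det, ← linearIndependent_rows_iff_isUnit]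
  exact hli.comp e e.injective

theorem exists_isLexFeasible
    (hbounded : ∃ R : ℝ, ∀ x ∈ PolyhedronOf A b, ∀ j, |x j| ≤ R)
    (hne : (PolyhedronOf A b).Nonempty) : ∃ r, IsLexFeasible A b r := by
  let tight : Matrix (Fin n) (Fin (m + 1)) ℝ → Set (Fin m) :=
    fun X => {i | (A * X) i = btilde b i}
  have hstart : ∃ X : Matrix (Fin n) (Fin (m + 1)) ℝ,
      ∀ i, toLex (btilde b i) ≤ toLex ((A * X) i) := by
    obtain ⟨x, hx⟩ := hne
    refine ⟨vecMulVec x (Pi.single 0 1), fun i => (lexLe_iff_toLex_le _ _).1 (Or.inr ?_)⟩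
    rw [mul_vecMulVec]
    rcases (hx i).lt_or_eq with h | h
    · refine ⟨0, fun j hj => absurd hj (Fin.not_lt_zero j), ?_⟩
      simpa [vecMulVec_apply, btilde_apply_zero] using h
    · refine ⟨i.succ, fun j hj => ?_, ?_⟩
      · cases j using Fin.cases with
        | zero => simpa [vecMulVec_apply, btilde_apply_zero] using h
        | succ k =>
          have hk : k ≠ i := (Fin.succ_lt_succ_iff.1 hj).ne
          simp [vecMulVec_apply, btilde_apply_succ, hk]
      · simp [vecMulVec_apply, btilde_apply_succ]
  obtain ⟨X₀, hX₀⟩ := hstart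
  obtain ⟨T, ⟨X, hX, rfl⟩, hmax⟩ := Set.Finite.exists_maximal
    (s := {T | ∃ X, (∀ i, toLex (btilde b i) ≤ toLex ((A * X) i)) ∧ tight X = T})
    (Set.toFinite _) ⟨_, X₀, hX₀, rfl⟩
  have hker : ∀ y : Fin n → ℝ, (∀ i ∈ tight X, (A *ᵥ y) i = 0) → y = 0 := by
    intro y hy
    by_contra hy0
    obtain ⟨t, -, ⟨i, hi, hi0, -⟩, hfeas⟩ := exists_lex_step hX (exists_mulVec_neg hbounded hne hy0)
    have hle : tight X ⊆ tight (X + vecMulVec y t) := fun k hk => by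
      have hk' : (A * X) k = btilde b k := hk
      change (A * (X + vecMulVec y t)) k = btilde b k
      rw [Matrix.mul_add, mul_vecMulVec, ← hk']
      ext c
      simp [vecMulVec_apply, hy k hk]
    exact hi.ne (hy i (hmax ⟨_, hfeas, rfl⟩ hle hi0))
  obtain ⟨r, hrT, hdet⟩ := exists_basis_of_kernel_trivial hker
  refine ⟨r, hdet, fun i => (lexLe_iff_toLex_le _ _).2 ?_⟩
  rw [← eq_basicMatrix hdet hrT]
  exact hX i

/-- A pivot of the lexicographic simplex method: unless `phi A b r` minimizes the objective `d`,
there is an adjacent lex-feasible basis which strictly improves `d` lexicographically. -/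
theorem IsLexFeasible.exists_pivot
    (hbounded : ∃ R : ℝ, ∀ x ∈ PolyhedronOf A b, ∀ j, |x j| ≤ R)
    {r : Fin n ↪ Fin m} (hr : IsLexFeasible A b r) {d x : Fin n → ℝ}
    (hx : x ∈ PolyhedronOf A b) (hlt : d ⬝ᵥ x < d ⬝ᵥ phi A b r) :
    ∃ r' : Fin n ↪ Fin m, IsLexFeasible A b r' ∧
      (Set.range r ∩ Set.range r').ncard = n - 1 ∧
      toLex (d ᵥ* basicMatrix A b r') < toLex (d ᵥ* basicMatrix A b r) := by
  have hdet := isUnit_iff_ne_zero.2 hr.1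
  set M := A.submatrix r id with hM
  have hd : ∀ z, d ⬝ᵥ z = (d ᵥ* M⁻¹) ⬝ᵥ (M *ᵥ z) := fun z => by
    rw [← dotProduct_mulVec, mulVec_mulVec, nonsing_inv_mul _ hdet, one_mulVec]
  obtain ⟨j, hj⟩ : ∃ j, (d ᵥ* M⁻¹) j < 0 := by
    by_contra! hnn
    refine hlt.not_ge ?_
    rw [hd, hd]
    refine dotProduct_le_dotProduct_of_nonneg_left (fun k => ?_) hnn
    exact (mulVec_phi_apply_mem hr.1 k).trans_le (hx (r k))
  set y := M⁻¹ *ᵥ Pi.single j 1 with hy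
  have hMy : M *ᵥ y = Pi.single j 1 := by
    rw [hy, mulVec_mulVec, mul_nonsing_inv _ hdet, one_mulVec]
  have hAy : ∀ k, (A *ᵥ y) (r k) = (Pi.single j 1 : Fin n → ℝ) k := fun k => congrFun hMy k
  have hy0 : y ≠ 0 := by
    intro h
    have := hAy j
    simp [h] at this
  have hdy : d ⬝ᵥ y < 0 := by
    rw [hd, hMy]
    simpa using hj
  obtain ⟨t, ht, ⟨i, hi, hi0, ht0⟩, hfeas⟩ := exists_lex_step
    (fun i => (lexLe_iff_toLex_le _ _).1 (hr.2 i)) (exists_mulVec_neg hbounded ⟨x, hx⟩ hy0)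
  have hir : i ∉ Set.range r := by
    rintro ⟨k, rfl⟩
    rw [hAy, Pi.single_apply] at hi
    split_ifs at hi <;> linarith
  have hne : ∀ k, r k ≠ i := fun k hk => hir ⟨k, hk⟩
  have htpos : 0 < toLex t := lt_of_le_of_ne ht fun h =>
    mul_basicMatrix_ne hir (ht0 (toLex_inj.1 h.symm))
  let r' : Fin n ↪ Fin m := ⟨fun k => if k = j then i else r k, fun k l h => by
    by_cases hk : k = j <;> by_cases hl : l = j <;> simp only [hk, hl, if_true, if_false] at h ⊢
    · exact absurd h.symm (hne l)
    · exact absurd h (hne k)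
    · exact r.injective h⟩
  have hr'j : r' j = i := if_pos rfl
  have hr'k : ∀ k, k ≠ j → r' k = r k := fun k hk => if_neg hk
  have hdet' : (A.submatrix r' id).det ≠ 0 := by
    intro h0
    obtain ⟨z, hz0, hz⟩ := exists_mulVec_eq_zero_iff.2 h0
    have hz' : ∀ k, (A *ᵥ z) (r' k) = 0 := fun k => congrFun hz k
    have hsub : z - (A *ᵥ z) (r j) • y = 0 := by
      refine eq_zero_of_mulVec_range_eq_zero hr.1 fun k => ?_
      rw [mulVec_sub, mulVec_smul, Pi.sub_apply, Pi.smul_apply, hAy]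
      rcases eq_or_ne k j with rfl | hk
      · simp
      · simp [hk, ← hr'k k hk, hz' k]
    have hzy := sub_eq_zero.1 hsub
    have hzi := hz' j
    rw [hr'j, hzy, mulVec_smul, Pi.smul_apply, smul_eq_mul] at hzi
    have hc := (mul_eq_zero.1 hzi).resolve_right hi.ne
    rw [hc, zero_smul] at hzy
    exact hz0 hzy
  have hX : basicMatrix A b r + vecMulVec y t = basicMatrix A b r' := by
    refine eq_basicMatrix hdet' fun k => ?_
    rcases eq_or_ne k j with rfl | hk
    · rw [hr'j, hi0]
    · rw [hr'k k hk, Matrix.mul_add, mul_vecMulVec, ← basicMatrix_apply_mem hr.1 k]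
      ext c
      simp [vecMulVec_apply, hAy, hk]
  refine ⟨r', ⟨hdet', fun k => (lexLe_iff_toLex_le _ _).2 (hX ▸ hfeas k)⟩, ?_, ?_⟩
  · have hinter : Set.range r ∩ Set.range r' = r '' {j}ᶜ := by
      ext l
      constructor
      · rintro ⟨⟨k, rfl⟩, k', hk'⟩
        refine ⟨k, ?_, rfl⟩
        rintro rfl
        rcases eq_or_ne k' k with rfl | hkk
        · exact hne k' (hk'.symm.trans hr'j)
        · exact hkk (r.injective ((hr'k k' hkk).symm.trans hk'))
      · rintro ⟨k, hk, rfl⟩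
        exact ⟨⟨k, rfl⟩, k, hr'k k hk⟩
    rw [hinter, Set.ncard_image_of_injective _ r.injective, Set.ncard_compl, Set.ncard_singleton,
      Nat.card_fin]
  · rw [← hX, vecMul_add, vecMul_vecMulVec, toLex_add]
    exact add_lt_of_neg_right _ (smul_neg_of_neg_of_pos hdy htpos)

theorem dotProduct_phi_le_of_toLex_le {r r' : Fin n ↪ Fin m} {d : Fin n → ℝ}
    (h : toLex (d ᵥ* basicMatrix A b r') ≤ toLex (d ᵥ* basicMatrix A b r)) :
    d ⬝ᵥ phi A b r' ≤ d ⬝ᵥ phi A b r :=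
  apply_zero_le_of_toLex_le h

/-- Summing the constraints indexed by `S` gives an objective whose optimal face is where all of
these constraints are tight. -/
theorem minimizers_sum_rows (S : Finset (Fin m)) {v : Fin n → ℝ} (hv : v ∈ PolyhedronOf A b)
    (hvS : ∀ i ∈ S, (A *ᵥ v) i = b i) :
    {x ∈ PolyhedronOf A b | ∀ y ∈ PolyhedronOf A b, (∑ i ∈ S, A i) ⬝ᵥ x ≤ (∑ i ∈ S, A i) ⬝ᵥ y} =
      {x ∈ PolyhedronOf A b | ∀ i ∈ S, (A *ᵥ x) i = b i} := by
  have hsum : ∀ x, (∑ i ∈ S, A i) ⬝ᵥ x = ∑ i ∈ S, (A *ᵥ x) i := fun x => sum_dotProduct _ _ _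
  ext x
  simp only [Set.mem_ofPred_eq, hsum]
  refine and_congr_right fun hx => ⟨fun h i hi => ?_, fun h y hy => ?_⟩
  · have hle := (h v hv).trans_eq (Finset.sum_congr rfl hvS)
    exact ((Finset.sum_eq_sum_iff_of_le fun i _ => hx i).1
      (le_antisymm (Finset.sum_le_sum fun i _ => hx i) hle) i hi).symm
  · rw [Finset.sum_congr rfl h]
    exact Finset.sum_le_sum fun i _ => hy i

theorem IsLexFeasible.isVertex {r : Fin n ↪ Fin m} (hr : IsLexFeasible A b r) :
    IsVertex (PolyhedronOf A b) (phi A b r) := by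
  refine ⟨∑ i ∈ Finset.univ.map r, A i, ?_⟩
  rw [minimizers_sum_rows _ hr.phi_mem (by simp [mulVec_phi_apply_mem hr.1])]
  ext x
  refine ⟨fun ⟨_, h⟩ => ?_, ?_⟩
  · refine sub_eq_zero.1 (eq_zero_of_mulVec_range_eq_zero hr.1 fun k => ?_)
    rw [mulVec_sub, Pi.sub_apply, mulVec_phi_apply_mem hr.1, h _ (by simp), sub_self]
  · rintro rfl
    exact ⟨hr.phi_mem, by simp [mulVec_phi_apply_mem hr.1]⟩

/-- A vertex lying on a segment contained in the polyhedron is an endpoint. -/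
theorem IsVertex.eq_or_eq_of_mem_segment {P : Set (Fin n → ℝ)} {u u' v : Fin n → ℝ}
    (hv : IsVertex P v) (hu : u ∈ P) (hu' : u' ∈ P) (h : v ∈ segment ℝ u u') :
    v = u ∨ v = u' := by
  obtain ⟨c, hc⟩ := hv
  obtain ⟨α, β, hα, hβ, hαβ, rfl⟩ := h
  have hmin := (hc.superset rfl).2
  have hone : ∀ w ∈ P, c ⬝ᵥ w ≤ c ⬝ᵥ (α • u + β • u') → w = α • u + β • u' := fun w hw hle =>
    hc.subset ⟨hw, fun y hy => hle.trans (hmin y hy)⟩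
  obtain rfl : α = 1 - β := by linarith
  rcases le_total (c ⬝ᵥ u) (c ⬝ᵥ u') with h | h
  · left
    refine (hone u hu ?_).symm
    simp only [dotProduct_add, dotProduct_smul, smul_eq_mul]
    linarith [mul_le_mul_of_nonneg_left h hβ]
  · right
    refine (hone u' hu' ?_).symm
    simp only [dotProduct_add, dotProduct_smul, smul_eq_mul]
    linarith [mul_le_mul_of_nonneg_left h hα]

/-- Every objective is minimized over a nonempty polytope by some lex-feasible basis. -/
theorem exists_isLexFeasible_minimizer
    (hbounded : ∃ R : ℝ, ∀ x ∈ PolyhedronOf A b, ∀ j, |x j| ≤ R)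
    (hne : (PolyhedronOf A b).Nonempty) (d : Fin n → ℝ) :
    ∃ r, IsLexFeasible A b r ∧ ∀ x ∈ PolyhedronOf A b, d ⬝ᵥ phi A b r ≤ d ⬝ᵥ x := by
  obtain ⟨r, hr, hmin⟩ := Set.exists_min_image {r | IsLexFeasible A b r}
    (fun r => toLex (d ᵥ* basicMatrix A b r)) (Set.toFinite _)
    (exists_isLexFeasible hbounded hne)
  refine ⟨r, hr, fun x hx => ?_⟩
  by_contra! hlt
  obtain ⟨r', hr', -, hdec⟩ := IsLexFeasible.exists_pivot hbounded hr hx hlt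
  exact (hmin r' hr').not_gt hdec

theorem IsVertex.exists_isLexFeasible
    (hbounded : ∃ R : ℝ, ∀ x ∈ PolyhedronOf A b, ∀ j, |x j| ≤ R) {u : Fin n → ℝ}
    (hu : IsVertex (PolyhedronOf A b) u) : ∃ r, IsLexFeasible A b r ∧ phi A b r = u := by
  obtain ⟨c, hc⟩ := hu
  obtain ⟨r, hr, hmin⟩ := exists_isLexFeasible_minimizer hbounded ⟨u, (hc.superset rfl).1⟩ c
  exact ⟨r, hr, hc.subset ⟨hr.phi_mem, hmin⟩⟩

/-- An objective `d` equivalent to minimizing `c` first and `w` second, relative to `u` and the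
points `phi A b r`. -/
theorem exists_refined_objective (A : Matrix (Fin m) (Fin n) ℝ) (b : Fin m → ℝ)
    (c w u : Fin n → ℝ) :
    ∃ d : Fin n → ℝ, (∀ x, c ⬝ᵥ x = c ⬝ᵥ u → d ⬝ᵥ x - d ⬝ᵥ u = w ⬝ᵥ (x - u)) ∧
      ∀ r, d ⬝ᵥ phi A b r ≤ d ⬝ᵥ u → c ⬝ᵥ phi A b r ≤ c ⬝ᵥ u := by
  obtain ⟨K, hK⟩ := (Set.finite_range fun r : Fin n ↪ Fin m =>
    (w ⬝ᵥ u - w ⬝ᵥ phi A b r) / (c ⬝ᵥ phi A b r - c ⬝ᵥ u)).bddAbove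
  have hd : ∀ x, ((K + 1) • c + w) ⬝ᵥ x = (K + 1) * (c ⬝ᵥ x) + w ⬝ᵥ x := fun x => by
    rw [add_dotProduct, smul_dotProduct, smul_eq_mul]
  refine ⟨(K + 1) • c + w, fun x hx => ?_, fun r hr => ?_⟩
  · rw [hd, hd, hx, dotProduct_sub]
    ring
  · by_contra! hlt
    have hlt' := sub_pos.2 hlt
    have h := (div_le_iff₀ hlt').1 (hK ⟨r, rfl⟩)
    rw [hd, hd] at hr
    linarith

theorem IsEdge.exists_isLexFeasible
    (hbounded : ∃ R : ℝ, ∀ x ∈ PolyhedronOf A b, ∀ j, |x j| ≤ R) {u u' : Fin n → ℝ}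
    (h : IsEdge (PolyhedronOf A b) u u') : ∃ r, IsLexFeasible A b r ∧ phi A b r = u := by
  obtain ⟨hne, c, hc⟩ := h
  obtain ⟨hu, hmin⟩ := hc.superset (left_mem_segment ℝ u u')
  obtain ⟨hu', hmin'⟩ := hc.superset (right_mem_segment ℝ u u')
  obtain ⟨d, hd, hdr⟩ := exists_refined_objective A b c (u' - u) u
  obtain ⟨r, hr, hrmin⟩ := exists_isLexFeasible_minimizer hbounded ⟨u, hu⟩ d
  have hseg : phi A b r ∈ segment ℝ u u' :=
    hc.subset ⟨hr.phi_mem, fun y hy => (hdr r (hrmin u hu)).trans (hmin y hy)⟩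
  refine ⟨r, hr, (hr.isVertex.eq_or_eq_of_mem_segment hu hu' hseg).resolve_right fun heq => ?_⟩
  have h1 := hd u' (le_antisymm (hmin' u hu) (hmin u' hu'))
  have h2 := hrmin u hu
  have h3 := dotProduct_star_self_pos_iff.2 (sub_ne_zero.2 hne.symm)
  rw [star_trivial] at h3
  rw [heq] at h2
  linarith

theorem IsEdge.exists_adjacent
    (hbounded : ∃ R : ℝ, ∀ x ∈ PolyhedronOf A b, ∀ j, |x j| ≤ R) {u u' : Fin n → ℝ}
    (h : IsEdge (PolyhedronOf A b) u u') :
    ∃ r r' : Fin n ↪ Fin m, IsLexFeasible A b r ∧ IsLexFeasible A b r' ∧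
      (Set.range r ∩ Set.range r').ncard = n - 1 ∧ phi A b r = u ∧ phi A b r' = u' := by
  have hbasis := h.exists_isLexFeasible hbounded
  obtain ⟨hne, c, hc⟩ := h
  obtain ⟨hu, hmin⟩ := hc.superset (left_mem_segment ℝ u u')
  obtain ⟨hu', hmin'⟩ := hc.superset (right_mem_segment ℝ u u')
  obtain ⟨d, hd, hdr⟩ := exists_refined_objective A b c (u - u') u
  obtain ⟨r, ⟨hr, hru⟩, hrmin⟩ := Set.exists_min_image {r | IsLexFeasible A b r ∧ phi A b r = u}
    (fun r => toLex (d ᵥ* basicMatrix A b r)) (Set.toFinite _) hbasis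
  have hlt : d ⬝ᵥ u' < d ⬝ᵥ phi A b r := by
    have h1 := hd u' (le_antisymm (hmin' u hu) (hmin u' hu'))
    have h3 := dotProduct_star_self_pos_iff.2 (sub_ne_zero.2 hne)
    rw [star_trivial] at h3
    rw [← neg_sub u u', dotProduct_neg] at h1
    rw [hru]
    linarith
  obtain ⟨r', hr', hadj, hdec⟩ := hr.exists_pivot hbounded hu' hlt
  have hle := dotProduct_phi_le_of_toLex_le hdec.le
  rw [hru] at hle
  have hseg : phi A b r' ∈ segment ℝ u u' :=
    hc.subset ⟨hr'.phi_mem, fun y hy => (hdr r' hle).trans (hmin y hy)⟩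
  refine ⟨r, r', hr, hr', hadj, hru,
    (hr'.isVertex.eq_or_eq_of_mem_segment hu hu' hseg).resolve_left fun heq => ?_⟩
  exact (hrmin r' ⟨hr', heq⟩).not_gt hdec

/-- Along the segment towards another basic point agreeing on all constraints of `r` but one, the
slack of the remaining constraint is positive. -/
theorem IsLexFeasible.exists_leaving {r r' : Fin n ↪ Fin m} (hr : IsLexFeasible A b r)
    (hr' : IsLexFeasible A b r') (hadj : (Set.range r ∩ Set.range r').ncard = n - 1)
    (hne : phi A b r ≠ phi A b r') :
    ∃ j, (∀ k, k ≠ j → r k ∈ Set.range r ∩ Set.range r') ∧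
      0 < (A *ᵥ (phi A b r' - phi A b r)) (r j) := by
  have hn : n ≠ 0 := by
    rintro rfl
    exact hne (Subsingleton.elim _ _)
  have hdiff : (Set.range r \ Set.range r').ncard = 1 := by
    have h := Set.ncard_inter_add_ncard_sdiff_eq_ncard (Set.range r) (Set.range r')
    rw [hadj, Set.ncard_range_of_injective r.injective, Nat.card_fin] at h
    lia
  obtain ⟨p, hp⟩ := Set.ncard_eq_one.1 hdiff
  obtain ⟨⟨j, rfl⟩, -⟩ := hp.superset rfl
  have hmem : ∀ k, k ≠ j → r k ∈ Set.range r ∩ Set.range r' := fun k hk => by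
    refine ⟨⟨k, rfl⟩, ?_⟩
    by_contra hk'
    exact hk (r.injective (hp.subset ⟨⟨k, rfl⟩, hk'⟩))
  refine ⟨j, hmem, lt_of_le_of_ne ?_ fun h0 => ?_⟩
  · rw [mulVec_sub, Pi.sub_apply, mulVec_phi_apply_mem hr.1]
    exact sub_nonneg.2 (hr'.phi_mem _)
  · refine hne.symm (sub_eq_zero.1 (eq_zero_of_mulVec_range_eq_zero hr.1 fun k => ?_))
    rcases eq_or_ne k j with rfl | hk
    · exact h0.symm
    · obtain ⟨-, l, hl⟩ := hmem k hk
      rw [mulVec_sub, Pi.sub_apply, mulVec_phi_apply_mem hr.1, ← hl, mulVec_phi_apply_mem hr'.1,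
        sub_self]

theorem IsLexFeasible.isEdge {r r' : Fin n ↪ Fin m} (hr : IsLexFeasible A b r)
    (hr' : IsLexFeasible A b r') (hadj : (Set.range r ∩ Set.range r').ncard = n - 1)
    (hne : phi A b r ≠ phi A b r') :
    IsEdge (PolyhedronOf A b) (phi A b r) (phi A b r') := by
  set S : Finset (Fin m) := (Set.toFinite (Set.range r ∩ Set.range r')).toFinset with hS
  have hrS : ∀ i ∈ S, (A *ᵥ phi A b r) i = b i := fun i hi => by
    obtain ⟨⟨k, rfl⟩, -⟩ := (Set.Finite.mem_toFinset _).1 hi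
    exact mulVec_phi_apply_mem hr.1 k
  have hrS' : ∀ i ∈ S, (A *ᵥ phi A b r') i = b i := fun i hi => by
    obtain ⟨-, k, rfl⟩ := (Set.Finite.mem_toFinset _).1 hi
    exact mulVec_phi_apply_mem hr'.1 k
  refine ⟨hne, ∑ i ∈ S, A i, ?_⟩
  rw [minimizers_sum_rows S hr.phi_mem hrS]
  ext x
  constructor
  · rintro ⟨hx, hxS⟩
    obtain ⟨j, hj, hpos⟩ := hr.exists_leaving hr' hadj hne
    obtain ⟨j', -, hpos'⟩ := hr'.exists_leaving hr (Set.inter_comm _ _ ▸ hadj) hne.symm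
    set v := phi A b r' - phi A b r with hv
    set t := ((A *ᵥ x) (r j) - b (r j)) / (A *ᵥ v) (r j) with ht
    have hxt : x = phi A b r + t • v := by
      rw [← sub_eq_zero]
      refine eq_zero_of_mulVec_range_eq_zero hr.1 fun k => ?_
      simp only [mulVec_sub, mulVec_add, mulVec_smul, Pi.sub_apply, Pi.add_apply, Pi.smul_apply,
        smul_eq_mul, mulVec_phi_apply_mem hr.1]
      rcases eq_or_ne k j with rfl | hk
      · rw [ht, div_mul_cancel₀ _ hpos.ne']
        ring
      · have hkS : r k ∈ S := (Set.Finite.mem_toFinset _).2 (hj k hk)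
        rw [hxS _ hkS, hv, mulVec_sub, Pi.sub_apply, hrS _ hkS, hrS' _ hkS]
        ring
    have ht0 : 0 ≤ t := div_nonneg (sub_nonneg.2 (hx _)) hpos.le
    have ht1 : 0 ≤ 1 - t := by
      refine nonneg_of_mul_nonneg_left ?_ hpos'
      have h := hx (r' j')
      have hx' : x = phi A b r' + (1 - t) • (phi A b r - phi A b r') := by
        rw [hxt, hv]
        module
      rw [hx', mulVec_add, mulVec_smul, Pi.add_apply, Pi.smul_apply, smul_eq_mul,
        mulVec_phi_apply_mem hr'.1] at h
      linarith
    refine ⟨1 - t, t, ht1, ht0, sub_add_cancel _ _, ?_⟩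
    rw [hxt, hv]
    module
  · rintro ⟨α, β, hα, hβ, hαβ, rfl⟩
    have hA : ∀ i, (A *ᵥ (α • phi A b r + β • phi A b r')) i =
        α * (A *ᵥ phi A b r) i + β * (A *ᵥ phi A b r') i := fun i => by
      simp [mulVec_add, mulVec_smul]
    refine ⟨fun i => ?_, fun i hi => ?_⟩
    · have h1 := mul_le_mul_of_nonneg_left (hr.phi_mem i) hα
      have h2 := mul_le_mul_of_nonneg_left (hr'.phi_mem i) hβ
      rw [hA]
      calc b i = α * b i + β * b i := by rw [← add_mul, hαβ, one_mul]
        _ ≤ _ := add_le_add h1 h2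
    · rw [hA, hrS i hi, hrS' i hi, ← add_mul, hαβ, one_mul]

end Polyhedron

/-- The vertex-edge graph of the polytope `P = {x : A x ≥ b}` is the image of the
graph of lex-feasible bases by `φ`. -/
theorem stmt12 {m n : ℕ} (A : Matrix (Fin m) (Fin n) ℝ) (b : Fin m → ℝ)
    (hbounded : ∃ R : ℝ, ∀ x ∈ PolyhedronOf A b, ∀ j, |x j| ≤ R) :
    (∀ u, IsVertex (PolyhedronOf A b) u ↔
        ∃ r : Fin n ↪ Fin m, IsLexFeasible A b r ∧ phi A b r = u) ∧
    (∀ u u', u ≠ u' →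
      (IsEdge (PolyhedronOf A b) u u' ↔
        ∃ r r' : Fin n ↪ Fin m, IsLexFeasible A b r ∧ IsLexFeasible A b r' ∧
          (Set.range r ∩ Set.range r').ncard = n - 1 ∧
          phi A b r = u ∧ phi A b r' = u')) := by
  refine ⟨fun u => ⟨fun hu => hu.exists_isLexFeasible hbounded, ?_⟩, fun u u' hne =>
    ⟨fun h => h.exists_adjacent hbounded, ?_⟩⟩
  · rintro ⟨r, hr, rfl⟩
    exact hr.isVertex
  · rintro ⟨r, r', hr, hr', hadj, rfl, rfl⟩
    exact hr.isEdge hr' hadj hne
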